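/- Let V be a finite-dimensional real inner product space, g₁, g₂ invertible linear maps on V, 0 < a ≤ 1, and p, q ∈ V nonzero, non-collinear vectors. Then |(δ(g₁ p, g₁ q)/δ(p,q))^a − (δ(g₂ p, g₂ q)/δ(p,q))^a| ≤ C₁(g₁,g₂)·‖g₁ − g₂‖, where C₁(g₁,g₂) := a·max{‖g₁‖·‖g₁⁻¹‖, ‖g₂‖·‖g₂⁻¹‖}^{2(1−a)}·C(g₁,g₂) and C(g₁,g₂) := (‖g₁⁻¹‖² + ‖g₂‖²·‖g₁⁻¹‖²·‖g₂⁻¹‖²)·(‖g₁‖ + ‖g₂‖). -/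

import Mathlib

open RealInnerProductSpace

/-- `δ(p,q) = √(1 − ⟪p,q⟫²/(‖p‖²‖q‖²))`, the sine of the angle between the lines
spanned by `p` and `q`. -/
noncomputable def pdelta {V : Type*} [NormedAddCommGroup V] [InnerProductSpace ℝ V]
    (p q : V) : ℝ :=
  Real.sqrt (1 - ⟪p, q⟫ ^ 2 / (‖p‖ ^ 2 * ‖q‖ ^ 2))


/-- Area of the parallelogram spanned by `u` and `v`. -/
noncomputable def warea {V : Type*} [NormedAddCommGroup V] [InnerProductSpace ℝ V]
    (u v : V) : ℝ :=
  Real.sqrt (‖u‖ ^ 2 * ‖v‖ ^ 2 - ⟪u, v⟫ ^ 2)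

section aux
variable {V : Type*} [NormedAddCommGroup V] [InnerProductSpace ℝ V]

lemma warea_nonneg (u v : V) : 0 ≤ warea u v := Real.sqrt_nonneg _

lemma warea_comm (u v : V) : warea u v = warea v u := by
  unfold warea
  rw [real_inner_comm, mul_comm]

lemma warea_le (u v : V) : warea u v ≤ ‖u‖ * ‖v‖ := by
  unfold warea
  apply Real.sqrt_le_iff.mpr
  exact ⟨by positivity, by nlinarith [sq_nonneg (⟪u, v⟫ : ℝ)]⟩

lemma warea_norm (u v : V) : ‖u‖ * warea u v = ‖(‖u‖ ^ 2) • v - (⟪u, v⟫ : ℝ) • u‖ := by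
  have h0 : (⟪u, v⟫ : ℝ) ^ 2 ≤ ‖u‖ ^ 2 * ‖v‖ ^ 2 := by
    rw [← mul_pow]
    exact sq_le_sq' (neg_le_of_abs_le (abs_real_inner_le_norm u v)) (real_inner_le_norm u v)
  have h1 : (‖u‖ * warea u v) ^ 2 = ‖(‖u‖ ^ 2) • v - (⟪u, v⟫ : ℝ) • u‖ ^ 2 := by
    rw [norm_sub_sq_real, mul_pow, warea, Real.sq_sqrt (by linarith), norm_smul, norm_smul,
      inner_smul_left, inner_smul_right, mul_pow, mul_pow, real_inner_comm u v]
    simp only [Real.norm_eq_abs, sq_abs, conj_trivial]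
    ring
  exact (pow_left_inj₀ (mul_nonneg (norm_nonneg _) (warea_nonneg _ _)) (norm_nonneg _)
    two_ne_zero).mp h1

lemma warea_sub_right (u v v' : V) : |warea u v - warea u v'| ≤ ‖u‖ * ‖v - v'‖ := by
  by_cases hu : u = 0
  · simp [hu, warea]
  have hu' : 0 < ‖u‖ := norm_pos_iff.mpr hu
  have h : ‖u‖ * |warea u v - warea u v'| ≤ ‖u‖ * warea u (v - v') := by
    rw [warea_norm, ← abs_of_pos hu', ← abs_mul, abs_of_pos hu', mul_sub, warea_norm, warea_norm]
    refine (abs_norm_sub_norm_le _ _).trans (le_of_eq ?_)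
    congr 1
    rw [inner_sub_right]
    module
  exact (le_of_mul_le_mul_left h hu').trans (warea_le _ _)

lemma warea_sub (u v u' v' : V) :
    |warea u v - warea u' v'| ≤ ‖u - u'‖ * ‖v‖ + ‖u'‖ * ‖v - v'‖ := by
  have h1 := warea_sub_right v u u'
  have h2 := warea_sub_right u' v v'
  rw [warea_comm v u, warea_comm v u'] at h1
  have := abs_sub_le (warea u v) (warea u' v) (warea u' v')
  linarith

lemma warea_shear (u v : V) (t : ℝ) : warea u (v - t • u) = warea u v := by
  unfold warea
  congr 1
  rw [norm_sub_sq_real, inner_sub_right, inner_smul_right, inner_smul_right, norm_smul, mul_pow,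
    real_inner_self_eq_norm_sq, Real.norm_eq_abs, sq_abs, real_inner_comm u v]
  ring

lemma warea_orth (p q : V) (hp : p ≠ 0) : ∃ t : ℝ, warea p q = ‖p‖ * ‖q - t • p‖ := by
  have hp' : 0 < ‖p‖ := norm_pos_iff.mpr hp
  refine ⟨⟪p, q⟫ / ‖p‖ ^ 2, ?_⟩
  rw [← warea_shear p q (⟪p, q⟫ / ‖p‖ ^ 2)]
  have : (⟪p, q - (⟪p, q⟫ / ‖p‖ ^ 2 : ℝ) • p⟫ : ℝ) = 0 := by
    rw [inner_sub_right, inner_smul_right, real_inner_self_eq_norm_sq]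
    field_simp
    ring
  rw [warea, this, ← mul_pow]
  simp only [ne_eq, OfNat.ofNat_ne_zero, not_false_eq_true, zero_pow, sub_zero]
  exact Real.sqrt_sq (by positivity)

lemma warea_map_le (g : V →L[ℝ] V) (p q : V) (hp : p ≠ 0) :
    warea (g p) (g q) ≤ ‖g‖ ^ 2 * warea p q := by
  obtain ⟨t, ht⟩ := warea_orth p q hp
  rw [ht, ← warea_shear (g p) (g q) t, ← map_smul, ← map_sub]
  calc _ ≤ ‖g p‖ * ‖g (q - t • p)‖ := warea_le _ _
    _ ≤ (‖g‖ * ‖p‖) * (‖g‖ * ‖q - t • p‖) := by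
      gcongr <;> exact g.le_opNorm _
    _ = _ := by ring

lemma warea_map_sub (g h : V →L[ℝ] V) (p q : V) (hp : p ≠ 0) :
    |warea (g p) (g q) - warea (h p) (h q)| ≤ (‖g‖ + ‖h‖) * ‖g - h‖ * warea p q := by
  obtain ⟨t, ht⟩ := warea_orth p q hp
  rw [ht, ← warea_shear (g p) (g q) t, ← warea_shear (h p) (h q) t, ← map_smul, ← map_sub,
    ← map_smul, ← map_sub]
  calc _ ≤ ‖(g - h) p‖ * ‖g (q - t • p)‖ + ‖h p‖ * ‖(g - h) (q - t • p)‖ := warea_sub _ _ _ _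
    _ ≤ (‖g - h‖ * ‖p‖) * (‖g‖ * ‖q - t • p‖) + (‖h‖ * ‖p‖) * (‖g - h‖ * ‖q - t • p‖) := by
      gcongr <;> exact ContinuousLinearMap.le_opNorm _ _
    _ = _ := by ring

lemma norm_map_sub (g h : V →L[ℝ] V) (p q : V) :
    |‖g p‖ * ‖g q‖ - ‖h p‖ * ‖h q‖| ≤ (‖g‖ + ‖h‖) * ‖g - h‖ * (‖p‖ * ‖q‖) := by
  calc _ = |(‖g p‖ - ‖h p‖) * ‖g q‖ + ‖h p‖ * (‖g q‖ - ‖h q‖)| := by congr 1; ring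
    _ ≤ |‖g p‖ - ‖h p‖| * ‖g q‖ + ‖h p‖ * |‖g q‖ - ‖h q‖| := by
      refine (abs_add_le _ _).trans ?_
      rw [abs_mul, abs_mul, abs_norm, abs_norm]
    _ ≤ ‖(g - h) p‖ * ‖g q‖ + ‖h p‖ * ‖(g - h) q‖ := by
      gcongr <;> exact abs_norm_sub_norm_le _ _
    _ ≤ (‖g - h‖ * ‖p‖) * (‖g‖ * ‖q‖) + (‖h‖ * ‖p‖) * (‖g - h‖ * ‖q‖) := by
      gcongr <;> exact ContinuousLinearMap.le_opNorm _ _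
    _ = _ := by ring

lemma warea_pos (p q : V) (hind : LinearIndependent ℝ ![p, q]) : 0 < warea p q := by
  refine lt_of_le_of_ne (warea_nonneg _ _) fun h => ?_
  have h1 := warea_norm p q
  rw [← h, mul_zero, eq_comm, norm_eq_zero] at h1
  have h2 := LinearIndependent.pair_iff.mp hind (-⟪p, q⟫) (‖p‖ ^ 2) (by rw [← h1]; module)
  have h3 : p = 0 := by simpa using h2.2
  exact hind.ne_zero 0 (by simpa using h3)

lemma pdelta_eq (p q : V) (hp : p ≠ 0) (hq : q ≠ 0) :
    pdelta p q = warea p q / (‖p‖ * ‖q‖) := by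
  have hp' : 0 < ‖p‖ := norm_pos_iff.mpr hp
  have hq' : 0 < ‖q‖ := norm_pos_iff.mpr hq
  have : (1 - ⟪p, q⟫ ^ 2 / (‖p‖ ^ 2 * ‖q‖ ^ 2) : ℝ)
      = (‖p‖ ^ 2 * ‖q‖ ^ 2 - ⟪p, q⟫ ^ 2) / (‖p‖ * ‖q‖) ^ 2 := by
    field_simp
  rw [pdelta, this, Real.sqrt_div' _ (by positivity), Real.sqrt_sq (by positivity), warea]

lemma rpow_lip (a c x y : ℝ) (ha0 : 0 < a) (ha1 : a ≤ 1) (hc : 0 < c) (hx : c ≤ x) (hy : c ≤ y) :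
    |x ^ a - y ^ a| ≤ a * c ^ (a - 1) * |x - y| := by
  have := (convex_Ici c).norm_image_sub_le_of_norm_hasDerivWithin_le (𝕜 := ℝ)
    (f := fun z : ℝ => z ^ a) (f' := fun z => a * z ^ (a - 1)) (C := a * c ^ (a - 1))
    (x := y) (y := x)
    (fun z hz => (Real.hasDerivAt_rpow_const
      (Or.inl (lt_of_lt_of_le hc hz).ne')).hasDerivWithinAt)
    (fun z hz => by
      have hz0 : 0 < z := lt_of_lt_of_le hc hz
      rw [Real.norm_of_nonneg (by positivity)]
      exact mul_le_mul_of_nonneg_left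
        (Real.rpow_le_rpow_of_nonpos hc hz (by linarith)) ha0.le) hy hx
  simpa using this

/-- Everything needed about one invertible map. -/
lemma one_map (g : V ≃L[ℝ] V) (p q : V) (hp : p ≠ 0) (hq : q ≠ 0) :
    ‖p‖ * ‖q‖ ≤ ‖(g.symm : V →L[ℝ] V)‖ ^ 2 * (‖g p‖ * ‖g q‖) ∧
    ‖g p‖ * ‖g q‖ ≤ ‖(g : V →L[ℝ] V)‖ ^ 2 * (‖p‖ * ‖q‖) ∧
    warea p q ≤ ‖(g.symm : V →L[ℝ] V)‖ ^ 2 * warea (g p) (g q) ∧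
    warea (g p) (g q) ≤ ‖(g : V →L[ℝ] V)‖ ^ 2 * warea p q := by
  have hgp : g p ≠ 0 := by simpa using hp
  refine ⟨?_, ?_, ?_, warea_map_le (g : V →L[ℝ] V) p q hp⟩
  · have h1 := (g.symm : V →L[ℝ] V).le_opNorm (g p)
    have h2 := (g.symm : V →L[ℝ] V).le_opNorm (g q)
    simp only [ContinuousLinearEquiv.coe_coe, ContinuousLinearEquiv.symm_apply_apply] at h1 h2
    calc _ ≤ _ := mul_le_mul h1 h2 (norm_nonneg _) (by positivity)
      _ = _ := by ring
  · have h1 := (g : V →L[ℝ] V).le_opNorm p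
    have h2 := (g : V →L[ℝ] V).le_opNorm q
    calc _ ≤ _ := mul_le_mul h1 h2 (norm_nonneg _) (by positivity)
      _ = _ := by ring
  · have := warea_map_le (g.symm : V →L[ℝ] V) (g p) (g q) hgp
    simpa using this

end aux

lemma ratio_lower (n m w b W N K : ℝ) (hK : 0 < K) (hK' : n * m ≤ K) (hn : 0 ≤ n) (hm : 0 ≤ m)
    (hw : 0 < w) (hb : 0 < b) (hN : 0 < N) (hW : 0 < W)
    (h1 : b ≤ n ^ 2 * N) (h2 : W ≤ m ^ 2 * w) : (K ^ 2)⁻¹ ≤ w / b / (W / N) := by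
  rw [div_div_div_eq, inv_eq_one_div, div_le_div_iff₀ (by positivity) (by positivity)]
  calc 1 * (b * W) ≤ (n ^ 2 * N) * (m ^ 2 * w) := by
        rw [one_mul]; gcongr
    _ = (n * m) ^ 2 * (w * N) := by ring
    _ ≤ K ^ 2 * (w * N) := by gcongr
    _ = _ := by ring

lemma ratio_sub (n₂ m₁ m₂ w₁ w₂ b₁ b₂ W N E : ℝ) (hE : 0 ≤ E)
    (hw₂ : 0 < w₂) (hb₁ : 0 < b₁) (hb₂ : 0 < b₂) (hN : 0 < N) (hW : 0 < W)
    (h1 : N ≤ m₁ ^ 2 * b₁) (h2 : N ≤ m₂ ^ 2 * b₂) (h3 : w₂ ≤ n₂ ^ 2 * W)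
    (hw : |w₁ - w₂| ≤ E * W) (hb : |b₁ - b₂| ≤ E * N) :
    |w₁ / b₁ / (W / N) - w₂ / b₂ / (W / N)|
      ≤ (m₁ ^ 2 + n₂ ^ 2 * m₁ ^ 2 * m₂ ^ 2) * E := by
  have e : w₁ / b₁ / (W / N) - w₂ / b₂ / (W / N)
      = (w₁ - w₂) / W * (N / b₁) + (w₂ / W) * (N / b₁) * (N / b₂) * (-((b₁ - b₂) / N)) := by
    field_simp
    ring
  have i1 : N / b₁ ≤ m₁ ^ 2 := by rwa [div_le_iff₀ hb₁]
  have i2 : N / b₂ ≤ m₂ ^ 2 := by rwa [div_le_iff₀ hb₂]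
  have i3 : w₂ / W ≤ n₂ ^ 2 := by rwa [div_le_iff₀ hW]
  have i4 : |(w₁ - w₂) / W| ≤ E := by rwa [abs_div, abs_of_pos hW, div_le_iff₀ hW]
  have i5 : |-((b₁ - b₂) / N)| ≤ E := by rwa [abs_neg, abs_div, abs_of_pos hN, div_le_iff₀ hN]
  rw [e]
  calc _ ≤ |(w₁ - w₂) / W| * (N / b₁)
        + (w₂ / W) * (N / b₁) * (N / b₂) * |-((b₁ - b₂) / N)| := by
        refine (abs_add_le _ _).trans (le_of_eq ?_)
        rw [abs_mul, abs_mul, abs_of_pos (show 0 < N / b₁ by positivity),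
          abs_of_pos (show 0 < (w₂ / W) * (N / b₁) * (N / b₂) by positivity)]
    _ ≤ E * m₁ ^ 2 + n₂ ^ 2 * m₁ ^ 2 * m₂ ^ 2 * E := by gcongr
    _ = _ := by ring

/-- Hölder-power version of the Lipschitz dependence of the projective
contraction ratio on the (invertible) linear map. -/
theorem pdelta_ratio_pow_lipschitz {V : Type*} [NormedAddCommGroup V] [InnerProductSpace ℝ V]
    [FiniteDimensional ℝ V]
    (g₁ g₂ : V ≃L[ℝ] V) (a : ℝ) (ha0 : 0 < a) (ha1 : a ≤ 1)
    (p q : V) (hp : p ≠ 0) (hq : q ≠ 0)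
    (hind : LinearIndependent ℝ ![p, q]) :
    |(pdelta (g₁ p) (g₁ q) / pdelta p q) ^ a - (pdelta (g₂ p) (g₂ q) / pdelta p q) ^ a|
      ≤ a * (max (‖(g₁ : V →L[ℝ] V)‖ * ‖(g₁.symm : V →L[ℝ] V)‖)
                 (‖(g₂ : V →L[ℝ] V)‖ * ‖(g₂.symm : V →L[ℝ] V)‖)) ^ (2 * (1 - a))
        * ((‖(g₁.symm : V →L[ℝ] V)‖ ^ 2
            + ‖(g₂ : V →L[ℝ] V)‖ ^ 2 * ‖(g₁.symm : V →L[ℝ] V)‖ ^ 2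
                * ‖(g₂.symm : V →L[ℝ] V)‖ ^ 2)
          * (‖(g₁ : V →L[ℝ] V)‖ + ‖(g₂ : V →L[ℝ] V)‖))
        * ‖(g₁ : V →L[ℝ] V) - (g₂ : V →L[ℝ] V)‖ := by
  have hg1p : g₁ p ≠ 0 := by simpa using hp
  have hg1q : g₁ q ≠ 0 := by simpa using hq
  have hg2p : g₂ p ≠ 0 := by simpa using hp
  have hg2q : g₂ q ≠ 0 := by simpa using hq
  have hW := warea_pos p q hind
  obtain ⟨A1, A2, A3, A4⟩ := one_map g₁ p q hp hq
  obtain ⟨B1, B2, B3, B4⟩ := one_map g₂ p q hp hq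
  have D := warea_map_sub (g₁ : V →L[ℝ] V) (g₂ : V →L[ℝ] V) p q hp
  have F := norm_map_sub (g₁ : V →L[ℝ] V) (g₂ : V →L[ℝ] V) p q
  simp only [ContinuousLinearEquiv.coe_coe] at D F
  rw [pdelta_eq _ _ hg1p hg1q, pdelta_eq _ _ hg2p hg2q, pdelta_eq _ _ hp hq]
  have hN : 0 < ‖p‖ * ‖q‖ := mul_pos (norm_pos_iff.mpr hp) (norm_pos_iff.mpr hq)
  have hb₁ : 0 < ‖g₁ p‖ * ‖g₁ q‖ := mul_pos (norm_pos_iff.mpr hg1p) (norm_pos_iff.mpr hg1q)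
  have hb₂ : 0 < ‖g₂ p‖ * ‖g₂ q‖ := mul_pos (norm_pos_iff.mpr hg2p) (norm_pos_iff.mpr hg2q)
  have hn₁ := norm_nonneg (g₁ : V →L[ℝ] V)
  have hn₂ := norm_nonneg (g₂ : V →L[ℝ] V)
  have hm₁ := norm_nonneg (g₁.symm : V →L[ℝ] V)
  have hm₂ := norm_nonneg (g₂.symm : V →L[ℝ] V)
  have hE := norm_nonneg ((g₁ : V →L[ℝ] V) - (g₂ : V →L[ℝ] V))
  have hw₁ : 0 < warea (g₁ p) (g₁ q) :=
    pos_of_mul_pos_right (lt_of_lt_of_le hW A3) (by positivity)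
  have hw₂ : 0 < warea (g₂ p) (g₂ q) :=
    pos_of_mul_pos_right (lt_of_lt_of_le hW B3) (by positivity)
  have hn₁' : 0 < ‖(g₁ : V →L[ℝ] V)‖ := by
    refine lt_of_le_of_ne hn₁ fun h => ?_
    rw [← h] at A4
    linarith
  have hm₁' : 0 < ‖(g₁.symm : V →L[ℝ] V)‖ := by
    refine lt_of_le_of_ne hm₁ fun h => ?_
    rw [← h] at A3
    linarith
  generalize ‖(g₁ : V →L[ℝ] V) - (g₂ : V →L[ℝ] V)‖ = d at *
  generalize ‖(g₁ : V →L[ℝ] V)‖ = n₁ at *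
  generalize ‖(g₂ : V →L[ℝ] V)‖ = n₂ at *
  generalize ‖(g₁.symm : V →L[ℝ] V)‖ = m₁ at *
  generalize ‖(g₂.symm : V →L[ℝ] V)‖ = m₂ at *
  have hK : 0 < max (n₁ * m₁) (n₂ * m₂) := lt_max_of_lt_left (mul_pos hn₁' hm₁')
  have L1 := ratio_lower n₁ m₁ _ _ _ _ _ hK (le_max_left _ _) hn₁ hm₁ hw₁ hb₁ hN hW A2 A3
  have L2 := ratio_lower n₂ m₂ _ _ _ _ _ hK (le_max_right _ _) hn₂ hm₂ hw₂ hb₂ hN hW B2 B3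
  have S := ratio_sub n₂ m₁ m₂ _ _ _ _ _ _ ((n₁ + n₂) * d) (by positivity) hw₂ hb₁ hb₂ hN hW
    A1 B1 B4 D F
  have R := rpow_lip a _ _ _ ha0 ha1 (by positivity) L1 L2
  generalize max (n₁ * m₁) (n₂ * m₂) = K at *
  have hKe : ((K ^ 2)⁻¹) ^ (a - 1) = K ^ (2 * (1 - a)) := by
    rw [Real.inv_rpow (by positivity), ← Real.rpow_neg (by positivity), ← Real.rpow_natCast,
      ← Real.rpow_mul hK.le]
    congr 1
    push_cast
    ring
  rw [hKe] at R
  refine R.trans ((mul_le_mul_of_nonneg_left S (by positivity)).trans (le_of_eq ?_))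
  ring
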